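/- arXiv:1804.07238 — 5 statements merged into one kernel-verified Lean document; each statement's English description precedes it below -/
import Mathlib

section
/- Assume L_S(α) > 0, and define φ2(α) ∈ [0, 2π) as the reduction of α − π/2 − φ1(α) modulo 2π, i.e. φ2(α) = 2π·Int.fract((α − π/2 − φ1(α))/(2π)). Then f'(α) = r − 2r·cos φ2(α); consequently f'(α) = 0 if and only if φ2(α) = π/3 or φ2(α) = 5π/3. Equivalently, f'(α) = 0 if and only if X(α)·sin α − Y(α)·cos α = L_S(α)/2. -/
open Real

/-- **Shortest Dubins path to a circle, LSL clockwise case: extremum condition.**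
With `X α = c + 2r·cos α`, `Y α = d + 2r·sin α − r`, `L_S α = √(X α² + Y α²)`,
`f α = L_S α + r·α`, and `φ1 α` the polar angle of `(X α, Y α)`, assume
`L_S α > 0` and set `φ2 = 2π·fract((α − π/2 − φ1 α)/(2π)) ∈ [0, 2π)`.
Then `f'(α) = r − 2r·cos φ2`, hence `f'(α) = 0 ↔ φ2 = π/3 ∨ φ2 = 5π/3`, and
equivalently `f'(α) = 0 ↔ X α·sin α − Y α·cos α = L_S α / 2`. -/
theorem lsl_cw_deriv_eq_zero_iff (c d r : ℝ) (hr : 0 < r)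
    (X Y LS f φ1 : ℝ → ℝ)
    (hX : ∀ a, X a = c + 2 * r * Real.cos a)
    (hY : ∀ a, Y a = d + 2 * r * Real.sin a - r)
    (hLS : ∀ a, LS a = Real.sqrt (X a ^ 2 + Y a ^ 2))
    (hf : ∀ a, f a = LS a + r * a)
    (hφ1 : ∀ a, φ1 a = Complex.arg ((X a : ℂ) + (Y a : ℂ) * Complex.I))
    (α : ℝ) (hpos : 0 < LS α)
    (φ2 : ℝ) (hφ2 : φ2 = 2 * π * Int.fract ((α - π / 2 - φ1 α) / (2 * π))) :
    deriv f α = r - 2 * r * Real.cos φ2 ∧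
    (deriv f α = 0 ↔ (φ2 = π / 3 ∨ φ2 = 5 * π / 3)) ∧
    (deriv f α = 0 ↔ X α * Real.sin α - Y α * Real.cos α = LS α / 2) := by
  have hπ := Real.pi_pos
  have hS : 0 < X α ^ 2 + Y α ^ 2 := by
    rw [hLS] at hpos
    exact Real.sqrt_pos.mp hpos
  have hX' : HasDerivAt X (2 * r * (-Real.sin α)) α := by
    rw [funext hX]
    exact ((Real.hasDerivAt_cos α).const_mul (2 * r)).const_add c
  have hY' : HasDerivAt Y (2 * r * Real.cos α) α := by
    rw [funext hY]
    exact (((Real.hasDerivAt_sin α).const_mul (2 * r)).const_add d).sub_const r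
  have hf' : HasDerivAt f (r - 2 * r * ((X α * Real.sin α - Y α * Real.cos α) / LS α)) α := by
    have h1 := ((hX'.pow 2).add (hY'.pow 2)).sqrt (ne_of_gt hS)
    have h2 := h1.add ((hasDerivAt_id α).const_mul r)
    have hfe : f = fun a => Real.sqrt (X a ^ 2 + Y a ^ 2) + r * a := by
      funext a
      rw [hf, hLS]
    rw [hfe]
    refine h2.congr_deriv ?_
    simp only [Pi.add_apply, Pi.pow_apply]
    rw [← hLS]
    field_simp
    push_cast
    ring
  have hnorm : ‖(X α : ℂ) + (Y α : ℂ) * Complex.I‖ = LS α := by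
    rw [Complex.norm_add_mul_I, hLS]
  have hz : (X α : ℂ) + (Y α : ℂ) * Complex.I ≠ 0 := by
    rw [← norm_pos_iff, hnorm]
    exact hpos
  have hc : Real.cos (φ1 α) = X α / LS α := by
    rw [hφ1, Complex.cos_arg hz, hnorm]
    simp
  have hs : Real.sin (φ1 α) = Y α / LS α := by
    rw [hφ1, Complex.sin_arg, hnorm]
    simp
  have hcos : Real.cos φ2 = (X α * Real.sin α - Y α * Real.cos α) / LS α := by
    have h1 : φ2 = (α - φ1 α - π / 2)
        - (⌊(α - π / 2 - φ1 α) / (2 * π)⌋ : ℤ) * (2 * π) := by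
      rw [hφ2, Int.fract]
      field_simp
      ring
    rw [h1, Real.cos_sub_int_mul_two_pi, Real.cos_sub_pi_div_two, Real.sin_sub, hc, hs]
    ring
  have hd : deriv f α = r - 2 * r * Real.cos φ2 := by
    rw [hf'.deriv, hcos]
  have hhalf : deriv f α = 0 ↔ Real.cos φ2 = 1 / 2 := by
    rw [hd]
    constructor
    · intro h
      have : r * (1 - 2 * Real.cos φ2) = 0 := by linarith
      rcases mul_eq_zero.mp this with h | h <;> linarith
    · intro h
      rw [h]
      ring
  have h0 : 0 ≤ φ2 := by
    rw [hφ2]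
    exact mul_nonneg (by positivity) (Int.fract_nonneg _)
  have h2 : φ2 < 2 * π := by
    rw [hφ2]
    have := Int.fract_lt_one ((α - π / 2 - φ1 α) / (2 * π))
    nlinarith
  refine ⟨hd, ?_, ?_⟩
  · rw [hhalf]
    constructor
    · intro h
      rcases le_total φ2 π with hle | hle
      · left
        exact Real.injOn_cos ⟨h0, hle⟩ ⟨by positivity, by linarith⟩
          (by rw [h, Real.cos_pi_div_three])
      · right
        have : 2 * π - φ2 = π / 3 :=
          Real.injOn_cos ⟨by linarith, by linarith⟩ ⟨by positivity, by linarith⟩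
            (by rw [Real.cos_two_pi_sub, h, Real.cos_pi_div_three])
        linarith
    · rintro (h | h)
      · rw [h, Real.cos_pi_div_three]
      · rw [h, show 5 * π / 3 = 2 * π - π / 3 by ring, Real.cos_two_pi_sub,
          Real.cos_pi_div_three]
  · rw [hhalf, hcos, div_eq_iff hpos.ne']
    constructor <;> intro h <;> linarith
end

section
/- Assume L_cc(α) > 2r. Then the function ψ2(β) = arctan(2r / L_S(β)) is differentiable at α with derivative (d/dα) ψ2(α) = −4r²·(Y(α)·cos α − X(α)·sin α) / (L_cc(α)² · L_S(α)). -/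
open Real

/-- **Shortest Dubins path to a circle, RSL clockwise case: derivative of the
angle `ψ2`.**  Fix `c d r : ℝ` with `r > 0`.  For `α : ℝ` let
`X α = c + 2r·cos α − r`, `Y α = d + 2r·sin α`, `L_cc α = √(X α² + Y α²)` and
`L_S α = √(L_cc α² − 4r²)`.  If `L_cc α > 2r`, then
`ψ2 : β ↦ arctan (2r / L_S β)` is differentiable at `α` with derivative
`ψ2'(α) = −4r²·(Y α·cos α − X α·sin α)/(L_cc α²·L_S α)`. -/
theorem rsl_cw_hasDerivAt_psi2 (c d r : ℝ) (hr : 0 < r)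
    (X Y Lcc LS : ℝ → ℝ)
    (hX : ∀ a, X a = c + 2 * r * Real.cos a - r)
    (hY : ∀ a, Y a = d + 2 * r * Real.sin a)
    (hLcc : ∀ a, Lcc a = Real.sqrt (X a ^ 2 + Y a ^ 2))
    (hLS : ∀ a, LS a = Real.sqrt (Lcc a ^ 2 - 4 * r ^ 2))
    (α : ℝ) (hα : Lcc α > 2 * r) :
    HasDerivAt (fun β => Real.arctan (2 * r / LS β))
      (-4 * r ^ 2 * (Y α * Real.cos α - X α * Real.sin α) /
        (Lcc α ^ 2 * LS α)) α := by
  have hsq : ∀ a, Lcc a ^ 2 = X a ^ 2 + Y a ^ 2 := fun a => by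
    rw [hLcc, Real.sq_sqrt (by positivity)]
  have hpos : 0 < Lcc α ^ 2 - 4 * r ^ 2 := by nlinarith
  have hS : 0 < LS α := by rw [hLS]; exact Real.sqrt_pos.mpr hpos
  have hS2 : LS α ^ 2 = Lcc α ^ 2 - 4 * r ^ 2 := by
    rw [hLS, Real.sq_sqrt hpos.le]
  have dX : HasDerivAt X (2 * r * -Real.sin α) α := by
    rw [funext hX]
    exact (((Real.hasDerivAt_cos α).const_mul (2 * r)).const_add c).sub_const r
  have dY : HasDerivAt Y (2 * r * Real.cos α) α := by
    rw [funext hY]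
    exact ((Real.hasDerivAt_sin α).const_mul (2 * r)).const_add d
  have dL : HasDerivAt LS (2 * r * (Y α * Real.cos α - X α * Real.sin α) / LS α) α := by
    have e : LS = fun a => Real.sqrt (X a ^ 2 + Y a ^ 2 - 4 * r ^ 2) := by
      funext a; rw [hLS, hsq]
    have hq : HasDerivAt (fun a => X a ^ 2 + Y a ^ 2 - 4 * r ^ 2)
        (2 * X α * (2 * r * -Real.sin α) + 2 * Y α * (2 * r * Real.cos α)) α := by
      have h := ((dX.pow 2).add (dY.pow 2)).sub_const (4 * r ^ 2)
      simpa using h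
    have h := hq.sqrt (by rw [← hsq]; exact hpos.ne')
    have e2 : Real.sqrt (X α ^ 2 + Y α ^ 2 - 4 * r ^ 2) = LS α := by rw [hLS, hsq]
    rw [e2] at h
    have h' := h.congr_of_eventuallyEq (Filter.EventuallyEq.of_eq e)
    refine h'.congr_deriv ?_
    field_simp
    ring
  have hL : 0 < Lcc α := by linarith
  have h : HasDerivAt (fun β => Real.arctan (2 * r / LS β)) _ α :=
    ((hasDerivAt_const α (2 * r)).div dL hS.ne').arctan
  convert h using 1
  have e3 : 1 + (2 * r / LS α) ^ 2 = Lcc α ^ 2 / LS α ^ 2 := by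
    field_simp
    linarith
  simp only [Pi.div_apply]
  rw [e3]
  field_simp
  ring
end

section
/- Assume L_cc(α) > 2r and that X(α) + i·Y(α) lies off the closed nonpositive real axis. Then the RSL length function g is differentiable at α with derivative g'(α) = r + 2r·cos(α + φ1(α)). -/
open Real

/-- **Shortest Dubins path to a circle, RSL clockwise case: derivative of the
path length.**  Fix `c d r : ℝ` with `r > 0`.  For `α : ℝ` let
`X α = c + 2r·cos α − r`, `Y α = d + 2r·sin α`, `L_cc α = √(X α² + Y α²)`,
`L_S α = √(L_cc α² − 4r²)`, `ψ1 α = arg (X α + i·Y α)`,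
`ψ2 α = arctan (2r / L_S α)`, `φ1 α = π/2 + ψ2 α − ψ1 α` (first arc angle),
and `g α = L_S α + r·(2ψ2 α − 2ψ1 α + α)` (the RSL path length up to an
additive constant and `2π`-multiples).  If `L_cc α > 2r` and `X α + i·Y α`
lies in the slit plane, then `g` is differentiable at `α` with derivative
`g'(α) = r + 2r·cos (α + φ1 α)`. -/
theorem rsl_cw_hasDerivAt (c d r : ℝ) (hr : 0 < r)
    (X Y Lcc LS ψ1 ψ2 φ1 g : ℝ → ℝ)
    (hX : ∀ a, X a = c + 2 * r * Real.cos a - r)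
    (hY : ∀ a, Y a = d + 2 * r * Real.sin a)
    (hLcc : ∀ a, Lcc a = Real.sqrt (X a ^ 2 + Y a ^ 2))
    (hLS : ∀ a, LS a = Real.sqrt (Lcc a ^ 2 - 4 * r ^ 2))
    (hψ1 : ∀ a, ψ1 a = Complex.arg ((X a : ℂ) + (Y a : ℂ) * Complex.I))
    (hψ2 : ∀ a, ψ2 a = Real.arctan (2 * r / LS a))
    (hφ1 : ∀ a, φ1 a = π / 2 + ψ2 a - ψ1 a)
    (hg : ∀ a, g a = LS a + r * (2 * ψ2 a - 2 * ψ1 a + a))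
    (α : ℝ) (hα : Lcc α > 2 * r)
    (hslit : ((X α : ℂ) + (Y α : ℂ) * Complex.I) ∈ Complex.slitPlane) :
    HasDerivAt g (r + 2 * r * Real.cos (α + φ1 α)) α := by
  have hXd : HasDerivAt X (-(2 * r * Real.sin α)) α := by
    have e : X = fun a => c + 2 * r * Real.cos a - r := funext hX
    rw [e]
    have := (((Real.hasDerivAt_cos α).const_mul (2 * r)).const_add c).sub_const r
    refine HasDerivAt.congr_deriv this (Eq.symm ?_)
    ring
  have hYd : HasDerivAt Y (2 * r * Real.cos α) α := by
    have e : Y = fun a => d + 2 * r * Real.sin a := funext hY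
    rw [e]
    exact ((Real.hasDerivAt_sin α).const_mul (2 * r)).const_add d
  have hL0 : 0 < Lcc α := by linarith
  have hLsq : ∀ a, Lcc a ^ 2 = X a ^ 2 + Y a ^ 2 := fun a => by
    rw [hLcc, Real.sq_sqrt (by positivity)]
  have hpos : 0 < X α ^ 2 + Y α ^ 2 - 4 * r ^ 2 := by
    rw [← hLsq]; nlinarith
  have hLSe : LS = fun a => Real.sqrt (X a ^ 2 + Y a ^ 2 - 4 * r ^ 2) := by
    funext a; rw [hLS, hLsq]
  have hS0 : 0 < LS α := by rw [hLSe]; exact Real.sqrt_pos.2 hpos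
  have hSsq : LS α ^ 2 = X α ^ 2 + Y α ^ 2 - 4 * r ^ 2 := by
    rw [hLSe]; exact Real.sq_sqrt hpos.le
  set s := Real.sin α with hs
  set k := Real.cos α with hk
  have hSd : HasDerivAt LS ((X α * (-(2 * r * s)) + Y α * (2 * r * k)) / LS α) α := by
    have h1 := (((hXd.pow 2).add (hYd.pow 2)).sub_const (4 * r ^ 2)).sqrt hpos.ne'
    have h2 : Real.sqrt (X α ^ 2 + Y α ^ 2 - 4 * r ^ 2) = LS α := by rw [hLSe]
    have e : HasDerivAt LS = HasDerivAt (fun a => Real.sqrt (X a ^ 2 + Y a ^ 2 - 4 * r ^ 2)) := by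
      rw [← hLSe]
    rw [e]
    refine HasDerivAt.congr_deriv h1 (Eq.symm ?_)
    simp only [Pi.add_apply, Pi.pow_apply]
    rw [h2]
    field_simp
    push_cast
    ring
  have hψ2d : HasDerivAt ψ2 (-(2 * r) * ((X α * (-(2 * r * s)) + Y α * (2 * r * k)) / LS α)
      / Lcc α ^ 2) α := by
    have e : ψ2 = fun a => Real.arctan (2 * r / LS a) := funext hψ2
    rw [e]
    have h1 := ((hasDerivAt_const α (2 * r)).div hSd hS0.ne').arctan
    refine HasDerivAt.congr_deriv h1 (Eq.symm ?_)
    have h4 : Lcc α ^ 2 = LS α ^ 2 + 4 * r ^ 2 := by rw [hLsq, hSsq]; ring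
    have h5 : 0 < LS α ^ 2 + 4 * r ^ 2 := by positivity
    have h6 : 1 + (2 * r / LS α) ^ 2 = (LS α ^ 2 + 4 * r ^ 2) / LS α ^ 2 := by
      field_simp; ring
    simp only [Pi.div_apply]
    rw [h4, h6]
    field_simp
    ring
  have hψ1d : HasDerivAt ψ1 ((X α * (2 * r * k) - Y α * (-(2 * r * s))) / Lcc α ^ 2) α := by
    have e : ψ1 = fun a => (Complex.log ((X a : ℂ) + (Y a : ℂ) * Complex.I)).im := by
      funext a; rw [hψ1, Complex.log_im]
    rw [e]
    have h1 := (hXd.ofReal_comp.add (hYd.ofReal_comp.mul_const Complex.I)).clog_real hslit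
    have h2 := Complex.imCLM.hasFDerivAt.comp_hasDerivAt α h1
    refine HasDerivAt.congr_deriv h2 (Eq.symm ?_)
    rw [hLsq]
    simp [Complex.div_im, Complex.normSq_apply, -Complex.ofReal_sin, -Complex.ofReal_cos]
    ring
  have hge : g = fun a => LS a + r * (2 * ψ2 a - 2 * ψ1 a + a) := funext hg
  rw [hge]
  have hgd := hSd.add ((((hψ2d.const_mul 2).sub (hψ1d.const_mul 2)).add (hasDerivAt_id α)).const_mul r)
  refine HasDerivAt.congr_deriv hgd (Eq.symm ?_)
  have hnorm : ‖(X α : ℂ) + (Y α : ℂ) * Complex.I‖ = Lcc α := by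
    rw [Complex.norm_add_mul_I, hLcc]
  have hne : (X α : ℂ) + (Y α : ℂ) * Complex.I ≠ 0 := Complex.slitPlane_ne_zero hslit
  have c1 : Real.cos (ψ1 α) = X α / Lcc α := by
    rw [hψ1, Complex.cos_arg hne, hnorm]; simp
  have s1 : Real.sin (ψ1 α) = Y α / Lcc α := by
    rw [hψ1, Complex.sin_arg, hnorm]; simp
  have hq : Real.sqrt (1 + (2 * r / LS α) ^ 2) = Lcc α / LS α := by
    have h4 : Lcc α ^ 2 = LS α ^ 2 + 4 * r ^ 2 := by rw [hLsq, hSsq]; ring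
    have h6 : 1 + (2 * r / LS α) ^ 2 = (Lcc α / LS α) ^ 2 := by
      rw [div_pow (Lcc α), h4]
      field_simp
      ring
    rw [h6, Real.sqrt_sq (by positivity)]
  have c2 : Real.cos (ψ2 α) = LS α / Lcc α := by
    rw [hψ2, Real.cos_arctan, hq]; field_simp
  have s2 : Real.sin (ψ2 α) = 2 * r / Lcc α := by
    rw [hψ2, Real.sin_arctan, hq]; field_simp
  have hcos : Real.cos (α + φ1 α) =
      -((s * X α - k * Y α) * LS α + (k * X α + s * Y α) * (2 * r)) / Lcc α ^ 2 := by
    rw [hφ1, show α + (π / 2 + ψ2 α - ψ1 α) = ((α - ψ1 α) + ψ2 α) + π / 2 by ring,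
      Real.cos_add_pi_div_two, Real.sin_add, Real.sin_sub, Real.cos_sub, c1, s1, c2, s2, ← hs, ← hk]
    field_simp
  rw [hcos]
  have h4 : Lcc α ^ 2 = LS α ^ 2 + 4 * r ^ 2 := by rw [hLsq, hSsq]; ring
  rw [h4]
  have h5 : LS α ^ 2 + 4 * r ^ 2 ≠ 0 := by positivity
  field_simp
  ring
end

section
/- Assume L_cc(α) > 2r and that X(α) + i·Y(α) lies off the closed nonpositive real axis, and define φ2(α) ∈ [0, 2π) as the reduction of α + φ1(α) − π modulo 2π, i.e. φ2(α) = 2π·Int.fract((α + φ1(α) − π)/(2π)). Then g'(α) = r − 2r·cos φ2(α); consequently g'(α) = 0 if and only if φ2(α) = π/3 or φ2(α) = 5π/3. -/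
open Real

/-- **Shortest Dubins path to a circle, RSL clockwise case: extremum condition.**
With `X α = c + 2r·cos α − r`, `Y α = d + 2r·sin α`, `L_cc α = √(X α² + Y α²)`,
`L_S α = √(L_cc α² − 4r²)`, `ψ1 α = arg (X α + i·Y α)`,
`ψ2 α = arctan (2r / L_S α)`, `φ1 α = π/2 + ψ2 α − ψ1 α`, and
`g α = L_S α + r·(2ψ2 α − 2ψ1 α + α)`, assume `L_cc α > 2r` and that
`X α + i·Y α` lies in the slit plane; set
`φ2 = 2π·fract((α + φ1 α − π)/(2π)) ∈ [0, 2π)` (the second arc angle).  Then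
`g'(α) = r − 2r·cos φ2`, hence `g'(α) = 0 ↔ φ2 = π/3 ∨ φ2 = 5π/3`. -/
theorem rsl_cw_deriv_eq_zero_iff (c d r : ℝ) (hr : 0 < r)
    (X Y Lcc LS ψ1 ψ2 φ1 g : ℝ → ℝ)
    (hX : ∀ a, X a = c + 2 * r * Real.cos a - r)
    (hY : ∀ a, Y a = d + 2 * r * Real.sin a)
    (hLcc : ∀ a, Lcc a = Real.sqrt (X a ^ 2 + Y a ^ 2))
    (hLS : ∀ a, LS a = Real.sqrt (Lcc a ^ 2 - 4 * r ^ 2))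
    (hψ1 : ∀ a, ψ1 a = Complex.arg ((X a : ℂ) + (Y a : ℂ) * Complex.I))
    (hψ2 : ∀ a, ψ2 a = Real.arctan (2 * r / LS a))
    (hφ1 : ∀ a, φ1 a = π / 2 + ψ2 a - ψ1 a)
    (hg : ∀ a, g a = LS a + r * (2 * ψ2 a - 2 * ψ1 a + a))
    (α : ℝ) (hα : Lcc α > 2 * r)
    (hslit : ((X α : ℂ) + (Y α : ℂ) * Complex.I) ∈ Complex.slitPlane)
    (φ2 : ℝ) (hφ2 : φ2 = 2 * π * Int.fract ((α + φ1 α - π) / (2 * π))) :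
    deriv g α = r - 2 * r * Real.cos φ2 ∧
    (deriv g α = 0 ↔ (φ2 = π / 3 ∨ φ2 = 5 * π / 3)) := by
  have hDpos : 0 < Lcc α := by linarith
  have hD2 : ∀ a, Lcc a ^ 2 = X a ^ 2 + Y a ^ 2 := fun a => by
    rw [hLcc, Real.sq_sqrt (by positivity)]
  have hpos : 0 < Lcc α ^ 2 - 4 * r ^ 2 := by nlinarith
  have hS2 : LS α ^ 2 = Lcc α ^ 2 - 4 * r ^ 2 := by
    rw [hLS, Real.sq_sqrt hpos.le]
  have hSpos : 0 < LS α := by rw [hLS]; exact Real.sqrt_pos.mpr hpos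
  have dX : HasDerivAt X (-(2 * r * Real.sin α)) α := by
    have h := (((Real.hasDerivAt_cos α).const_mul (2 * r)).const_add c).sub_const r
    rw [show X = fun a => c + 2 * r * Real.cos a - r from funext hX]
    refine h.congr_deriv ?_
    ring
  have dY : HasDerivAt Y (2 * r * Real.cos α) α := by
    have h := ((Real.hasDerivAt_sin α).const_mul (2 * r)).const_add d
    rw [show Y = fun a => d + 2 * r * Real.sin a from funext hY]
    exact h
  have dS : HasDerivAt LS
      (2 * r * (Y α * Real.cos α - X α * Real.sin α) / LS α) α := by
    have h0 : HasDerivAt (fun a => X a ^ 2 + Y a ^ 2 - 4 * r ^ 2)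
        (2 * (2 * r * (Y α * Real.cos α - X α * Real.sin α))) α := by
      have h := ((dX.fun_pow 2).fun_add (dY.fun_pow 2)).sub_const (4 * r ^ 2)
      refine h.congr_deriv ?_
      push_cast
      ring
    have hne : X α ^ 2 + Y α ^ 2 - 4 * r ^ 2 ≠ 0 := by rw [← hD2]; exact hpos.ne'
    have h1 := h0.sqrt hne
    have e : LS = fun a => Real.sqrt (X a ^ 2 + Y a ^ 2 - 4 * r ^ 2) := by
      funext a; rw [hLS, hD2]
    have e1 : Real.sqrt (X α ^ 2 + Y α ^ 2 - 4 * r ^ 2) = LS α := by rw [e]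
    rw [e1, ← e] at h1
    refine h1.congr_deriv ?_
    field_simp
  have dψ2 : HasDerivAt ψ2
      (-(2 * r) * (2 * r * (Y α * Real.cos α - X α * Real.sin α) / LS α) / Lcc α ^ 2) α := by
    have h := ((hasDerivAt_const α (2 * r)).fun_div dS hSpos.ne').arctan
    rw [show ψ2 = fun a => Real.arctan (2 * r / LS a) from funext hψ2]
    refine h.congr_deriv ?_
    have : Lcc α ^ 2 = LS α ^ 2 + (2 * r) ^ 2 := by rw [hS2]; ring
    rw [this]
    have : LS α ^ 2 + (2 * r) ^ 2 ≠ 0 := by positivity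
    have : 1 + (2 * r / LS α) ^ 2 ≠ 0 := by positivity
    field_simp
    ring
  have hzre : ((X α : ℂ) + (Y α : ℂ) * Complex.I).re = X α := by simp
  have hzim : ((X α : ℂ) + (Y α : ℂ) * Complex.I).im = Y α := by simp
  have dψ1 : HasDerivAt ψ1
      (2 * r * (X α * Real.cos α + Y α * Real.sin α) / Lcc α ^ 2) α := by
    have h := (dX.ofReal_comp.fun_add (dY.ofReal_comp.mul_const Complex.I)).clog_real hslit
    have h2 := Complex.imCLM.hasFDerivAt.comp_hasDerivAt α h
    have e : ψ1 = (⇑Complex.imCLM ∘ fun t => Complex.log ((X t : ℂ) + (Y t : ℂ) * Complex.I)) := by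
      funext a; simp [hψ1, Complex.log_im]
    rw [e]
    refine h2.congr_deriv ?_
    rw [Complex.imCLM_apply, Complex.div_im, Complex.normSq_apply, hzre, hzim, hD2]
    have : X α ^ 2 + Y α ^ 2 ≠ 0 := by rw [← hD2]; positivity
    simp [-Complex.ofReal_cos, -Complex.ofReal_sin]
    field_simp
    ring
  have dg := dS.fun_add ((((dψ2.const_mul 2).fun_sub (dψ1.const_mul 2)).fun_add
    (hasDerivAt_id' α)).const_mul r)
  rw [← show g = _ from funext hg] at dg
  have hnorm : ‖(X α : ℂ) + (Y α : ℂ) * Complex.I‖ = Lcc α := by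
    rw [Complex.norm_add_mul_I, hLcc]
  have hz0 : (X α : ℂ) + (Y α : ℂ) * Complex.I ≠ 0 := Complex.slitPlane_ne_zero hslit
  have hc1 : Real.cos (ψ1 α) = X α / Lcc α := by
    rw [hψ1, Complex.cos_arg hz0, hzre, hnorm]
  have hs1 : Real.sin (ψ1 α) = Y α / Lcc α := by
    rw [hψ1, Complex.sin_arg, hzim, hnorm]
  have hsq : Real.sqrt (1 + (2 * r / LS α) ^ 2) = Lcc α / LS α := by
    rw [show 1 + (2 * r / LS α) ^ 2 = (Lcc α / LS α) ^ 2 by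
      field_simp; rw [hS2]; ring]
    exact Real.sqrt_sq (by positivity)
  have hc2 : Real.cos (ψ2 α) = LS α / Lcc α := by
    rw [hψ2, Real.cos_arctan, hsq]; field_simp
  have hs2 : Real.sin (ψ2 α) = 2 * r / Lcc α := by
    rw [hψ2, Real.sin_arctan, hsq]; field_simp
  have hφ2' : φ2 = (α + φ1 α - π) - (⌊(α + φ1 α - π) / (2 * π)⌋ : ℤ) * (2 * π) := by
    rw [hφ2, Int.fract]; field_simp
  have hcos : Real.cos φ2 = Real.sin (α + ψ2 α - ψ1 α) := by
    rw [hφ2', Real.cos_sub_int_mul_two_pi, hφ1, ← Real.cos_sub_pi_div_two]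
    congr 1; ring
  have key : deriv g α = r - 2 * r * Real.cos φ2 := by
    rw [dg.deriv, hcos, Real.sin_sub, Real.sin_add, Real.cos_add, hc1, hs1, hc2, hs2]
    have hD : Lcc α ^ 2 = LS α ^ 2 + 4 * r ^ 2 := by rw [hS2]; ring
    field_simp
    rw [hD]
    ring
  refine ⟨key, ?_⟩
  have hpi := Real.pi_pos
  have h0 : 0 ≤ φ2 := by rw [hφ2]; have := Int.fract_nonneg ((α + φ1 α - π) / (2 * π)); positivity
  have h1 : φ2 < 2 * π := by
    rw [hφ2]; have := Int.fract_lt_one ((α + φ1 α - π) / (2 * π)); nlinarith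
  rw [key]
  constructor
  · intro h
    have hc : Real.cos φ2 = Real.cos (π / 3) := by
      rw [Real.cos_pi_div_three]
      have : r * (1 - 2 * Real.cos φ2) = 0 := by linarith
      rcases mul_eq_zero.mp this with h | h <;> linarith
    rcases le_total φ2 π with hle | hle
    · left
      exact Real.injOn_cos ⟨h0, hle⟩ ⟨by positivity, by linarith⟩ hc
    · right
      have : 2 * π - φ2 = π / 3 := by
        refine Real.injOn_cos ⟨by linarith, by linarith⟩ ⟨by positivity, by linarith⟩ ?_
        rw [Real.cos_two_pi_sub, hc]
      linarith
  · rintro (h | h)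
    · rw [h, Real.cos_pi_div_three]; ring
    · rw [h, show 5 * π / 3 = 2 * π - π / 3 by ring, Real.cos_two_pi_sub,
        Real.cos_pi_div_three]; ring
end

section
/- Let α₀ ∈ ℝ satisfy α₀ + φ̄1 ∈ 2π·ℤ. Then G is continuous from the right at α₀, while the left-hand limit of G at α₀ equals G(α₀) + 2πr; i.e. the counter-clockwise RSL length function has a jump discontinuity of size 2πr exactly at the minimizing angular position, and is continuous elsewhere. -/
open Real

/-- **Shortest Dubins path to a circle, RSL counter-clockwise case: the jump
discontinuity.**  Fix `c d r : ℝ` with `r > 0` and `L̄ = √((c − r)² + d²) > 2r`.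
Set `L_S = √(L̄² − 4r²)`, `ψ̄1 = arg ((c − r) + i·d)`,
`ψ̄2 = arctan (2r / L_S)`, `φ̄1 = ⟦π/2 + ψ̄2 − ψ̄1⟧ ∈ [0, 2π)` (reduction mod
`2π`), and define the counter-clockwise RSL length
`G α = L_S + r·φ̄1 + r·⟦α + φ̄1⟧`.  If `α₀ + φ̄1 ∈ 2π·ℤ`, then `G` is
continuous from the right at `α₀` while its left-hand limit at `α₀` is
`G α₀ + 2πr`: the length function has a jump of size `2πr` exactly at the
minimizing angular position, and is continuous elsewhere. -/
theorem rsl_ccw_jump (c d r : ℝ) (hr : 0 < r)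
    (Lbar LS ψbar1 ψbar2 φbar1 : ℝ) (G : ℝ → ℝ)
    (hLbar : Lbar = Real.sqrt ((c - r) ^ 2 + d ^ 2))
    (hL : Lbar > 2 * r)
    (hLS : LS = Real.sqrt (Lbar ^ 2 - 4 * r ^ 2))
    (hψ1 : ψbar1 = Complex.arg (((c - r : ℝ) : ℂ) + (d : ℂ) * Complex.I))
    (hψ2 : ψbar2 = Real.arctan (2 * r / LS))
    (hφ : φbar1 = 2 * π * Int.fract ((π / 2 + ψbar2 - ψbar1) / (2 * π)))
    (hG : ∀ a, G a = LS + r * φbar1 + r * (2 * π * Int.fract ((a + φbar1) / (2 * π))))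
    (α₀ : ℝ) (hα₀ : ∃ n : ℤ, α₀ + φbar1 = 2 * π * n) :
    ContinuousWithinAt G (Set.Ici α₀) α₀ ∧
    Filter.Tendsto G (nhdsWithin α₀ (Set.Iio α₀)) (nhds (G α₀ + 2 * π * r)) ∧
    ∀ β : ℝ, (¬ ∃ n : ℤ, β + φbar1 = 2 * π * n) → ContinuousAt G β := by
  obtain ⟨n, hn⟩ := hα₀
  have hp : (0 : ℝ) < 2 * π := by positivity
  have hGe : G = fun a => LS + r * φbar1 + r * (2 * π * Int.fract ((a + φbar1) / (2 * π))) :=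
    funext hG
  have hx : (α₀ + φbar1) / (2 * π) = n := by
    rw [hn]
    field_simp
  have hG0 : G α₀ = LS + r * φbar1 := by
    rw [hG, hx, Int.fract_intCast]
    ring
  have hc : Continuous (fun a : ℝ => (a + φbar1) / (2 * π)) := by fun_prop
  have ht : Filter.Tendsto (fun a : ℝ => (a + φbar1) / (2 * π)) (nhds α₀) (nhds (n : ℝ)) := by
    rw [← hx]
    exact hc.tendsto α₀
  refine ⟨?_, ?_, ?_⟩
  · have h1 : Filter.Tendsto (fun a : ℝ => (a + φbar1) / (2 * π))
        (nhdsWithin α₀ (Set.Ici α₀)) (nhdsWithin (n : ℝ) (Set.Ici (n : ℝ))) := by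
      refine tendsto_nhdsWithin_of_tendsto_nhds_of_eventually_within _
        (ht.mono_left nhdsWithin_le_nhds) ?_
      filter_upwards [self_mem_nhdsWithin] with a ha
      rw [Set.mem_Ici] at ha ⊢
      rw [← hx]
      gcongr
    have h2 := (((tendsto_fract_right' n).comp h1).const_mul (2 * π)).const_mul r
    have h3 := h2.const_add (LS + r * φbar1)
    unfold ContinuousWithinAt
    rw [hG0, hGe]
    simpa [Function.comp_def] using h3
  · have h1 : Filter.Tendsto (fun a : ℝ => (a + φbar1) / (2 * π))
        (nhdsWithin α₀ (Set.Iio α₀)) (nhdsWithin (n : ℝ) (Set.Iio (n : ℝ))) := by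
      refine tendsto_nhdsWithin_of_tendsto_nhds_of_eventually_within _
        (ht.mono_left nhdsWithin_le_nhds) ?_
      filter_upwards [self_mem_nhdsWithin] with a ha
      rw [Set.mem_Iio] at ha ⊢
      rw [← hx]
      gcongr
    have h2 := (((tendsto_fract_left' n).comp h1).const_mul (2 * π)).const_mul r
    have h3 := h2.const_add (LS + r * φbar1)
    have e : LS + r * φbar1 + 2 * π * r = LS + r * φbar1 + r * (2 * π * 1) := by ring
    rw [hG0, hGe, e]
    exact h3
  · intro β hβ
    have hne : (β + φbar1) / (2 * π) ≠ ⌊(β + φbar1) / (2 * π)⌋ := by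
      intro h
      refine hβ ⟨⌊(β + φbar1) / (2 * π)⌋, ?_⟩
      rw [← h]
      field_simp
    have h1 : ContinuousAt (fun a : ℝ => Int.fract ((a + φbar1) / (2 * π))) β :=
      ContinuousAt.comp (g := Int.fract) (f := fun a : ℝ => (a + φbar1) / (2 * π))
        (continuousAt_fract hne) hc.continuousAt
    rw [hGe]
    exact continuousAt_const.add (continuousAt_const.mul (continuousAt_const.mul h1))
end
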